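/- Let C be a complete and cocomplete monoidal category that is closed on both sides (each functor X ⊗ − and − ⊗ X has a right adjoint). Let I and J be sets of morphisms of C such that: (1) every morphism of C factors as an I-cofibration followed by an I-fibration, and as a J-cofibration followed by a J-fibration; (2) every member of J is an I-cofibration; (3) for all i, i' ∈ I the pushout-product i □ i' is an I-cofibration; (4) for all i ∈ I and j ∈ J, both i □ j and j □ i have the left lifting property against every J-fibration between J-fibrant objects; (5) the monoidal unit 𝟙 is I-cofibrant; (6) there is a commutative square consisting of an I-cofibration 𝟙 ⊔ 𝟙 → C₀, the codiagonal 𝟙 ⊔ 𝟙 → 𝟙, a morphism C₀ → D and a morphism 𝟙 → D, such that 𝟙 → D and the composite of the first coprojection 𝟙 → 𝟙 ⊔ 𝟙 → C₀ are I-cofibrations with the left lifting property against every J-fibration between J-fibrant objects. Then C, equipped with the I-cofibrations as cofibrations and the J-fibrations as fibrations, is a weak model category. -/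

import Mathlib

open CategoryTheory CategoryTheory.Limits

universe w v u

namespace WMC

variable {C : Type u} [Category.{v} C]

/-- An object is cofibrant when the map from the initial object is a cofibration. -/
def Cofibrant [HasInitial C] (Cof : MorphismProperty C) (X : C) : Prop :=
  Cof (initial.to X)

/-- An object is fibrant when the map to the terminal object is a fibration. -/
def Fibrant [HasTerminal C] (Fib : MorphismProperty C) (X : C) : Prop :=
  Fib (terminal.from X)

/-- The axioms for a class of cofibrations. -/
structure IsCofClass [HasInitial C] (Cof : MorphismProperty C) : Prop where
  initial_cofibrant : Cofibrant Cof (⊥_ C)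
  iso_mem : ∀ {X Y : C} (f : X ⟶ Y), IsIso f → Cofibrant Cof X → Cof f
  comp_mem : ∀ {X Y Z : C} (f : X ⟶ Y) (g : Y ⟶ Z), Cof f → Cof g → Cof (f ≫ g)
  pushout_mem : ∀ {A B X : C} (i : A ⟶ B) (f : A ⟶ X), Cof i → Cofibrant Cof A →
    Cofibrant Cof X →
    ∃ (P : C) (inl : X ⟶ P) (inr : B ⟶ P), IsPushout f i inl inr ∧ Cof inl

/-- The axioms for a class of fibrations (a class of cofibrations on `Cᵒᵖ`). -/
structure IsFibClass [HasTerminal C] (Fib : MorphismProperty C) : Prop where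
  terminal_fibrant : Fibrant Fib (⊤_ C)
  iso_mem : ∀ {X Y : C} (f : X ⟶ Y), IsIso f → Fibrant Fib Y → Fib f
  comp_mem : ∀ {X Y Z : C} (f : X ⟶ Y) (g : Y ⟶ Z), Fib f → Fib g → Fib (f ≫ g)
  pullback_mem : ∀ {A B X : C} (p : B ⟶ A) (f : X ⟶ A), Fib p → Fibrant Fib A →
    Fibrant Fib X →
    ∃ (P : C) (fst : P ⟶ X) (snd : P ⟶ B), IsPullback fst snd f p ∧ Fib fst

variable [HasInitial C] [HasTerminal C]

/-- Acyclic fibration: a fibration with the right lifting property against all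
cofibrations between cofibrant objects. -/
def IsAcyclicFib (Cof Fib : MorphismProperty C) {X Y : C} (p : X ⟶ Y) : Prop :=
  Fib p ∧ ∀ {A B : C} (i : A ⟶ B), Cof i → Cofibrant Cof A → Cofibrant Cof B →
    HasLiftingProperty i p

/-- Acyclic cofibration: a cofibration with the left lifting property against all
fibrations between fibrant objects. -/
def IsAcyclicCof (Cof Fib : MorphismProperty C) {A B : C} (i : A ⟶ B) : Prop :=
  Cof i ∧ ∀ {X Y : C} (p : X ⟶ Y), Fib p → Fibrant Fib X → Fibrant Fib Y →
    HasLiftingProperty i p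

/-- A relative strong cylinder object for a cofibration `i : A ⟶ B`: a factorization
`B ⊔_A B ⟶ I_A B ⟶ B` of the codiagonal, with the first map a cofibration whose
precomposition with the first coprojection is an acyclic cofibration. -/
structure RelStrongCylinder (Cof Fib : MorphismProperty C) {A B : C} (i : A ⟶ B) where
  BB : C
  in₀ : B ⟶ BB
  in₁ : B ⟶ BB
  isPushout : IsPushout i i in₀ in₁
  Cyl : C
  ι : BB ⟶ Cyl
  ρ : Cyl ⟶ B
  ι_cof : Cof ι
  in₀_ι_acyclic : IsAcyclicCof Cof Fib (in₀ ≫ ι)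
  fac₀ : in₀ ≫ ι ≫ ρ = 𝟙 B
  fac₁ : in₁ ≫ ι ≫ ρ = 𝟙 B

/-- A relative strong path object for a fibration `q : Y ⟶ X`: a factorization
`Y ⟶ P_X Y ⟶ Y ×_X Y` of the relative diagonal, with the second map a fibration whose
postcomposition with the first projection is an acyclic fibration. -/
structure RelStrongPath (Cof Fib : MorphismProperty C) {X Y : C} (q : Y ⟶ X) where
  YY : C
  pr₀ : YY ⟶ Y
  pr₁ : YY ⟶ Y
  isPullback : IsPullback pr₀ pr₁ q q
  Pth : C
  π : Pth ⟶ YY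
  σ : Y ⟶ Pth
  π_fib : Fib π
  π_pr₀_acyclic : IsAcyclicFib Cof Fib (π ≫ pr₀)
  fac₀ : σ ≫ π ≫ pr₀ = 𝟙 Y
  fac₁ : σ ≫ π ≫ pr₁ = 𝟙 Y

/-- A weak model category: a class of cofibrations and a class of fibrations satisfying
the factorization axiom, the cylinder axiom and the path object axiom. -/
structure IsWeakModel (Cof Fib : MorphismProperty C) : Prop where
  cofClass : IsCofClass Cof
  fibClass : IsFibClass Fib
  factor_cof_afib : ∀ {X Y : C} (f : X ⟶ Y), Cofibrant Cof X → Fibrant Fib Y →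
    ∃ (Z : C) (i : X ⟶ Z) (q : Z ⟶ Y), Cof i ∧ IsAcyclicFib Cof Fib q ∧ i ≫ q = f
  factor_acof_fib : ∀ {X Y : C} (f : X ⟶ Y), Cofibrant Cof X → Fibrant Fib Y →
    ∃ (Z : C) (i : X ⟶ Z) (q : Z ⟶ Y), IsAcyclicCof Cof Fib i ∧ Fib q ∧ i ≫ q = f
  cylinder : ∀ {A B : C} (i : A ⟶ B), Cof i → Cofibrant Cof A → Fibrant Fib B →
    Nonempty (RelStrongCylinder Cof Fib i)
  pathObj : ∀ {X Y : C} (q : Y ⟶ X), Fib q → Cofibrant Cof Y → Fibrant Fib X →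
    Nonempty (RelStrongPath Cof Fib q)

/-- `Rlp S`: the morphisms with the right lifting property against every member of `S`
(the `S`-fibrations). -/
def Rlp {D : Type*} [Category D] (S : MorphismProperty D) : MorphismProperty D :=
  fun _ _ p => ∀ ⦃A B : D⦄ (i : A ⟶ B), S i → HasLiftingProperty i p

/-- `Llp S`: the morphisms with the left lifting property against every member of `S`;
in particular `Llp (Rlp S)` is the class of `S`-cofibrations. -/
def Llp {D : Type*} [Category D] (S : MorphismProperty D) : MorphismProperty D :=
  fun _ _ i => ∀ ⦃X Y : D⦄ (p : X ⟶ Y), S p → HasLiftingProperty i p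

open MonoidalCategory

variable [MonoidalCategory C] [HasColimits C]

/-- The pushout-product of two morphisms with respect to the monoidal structure. -/
noncomputable def pp {A B X Y : C} (f : A ⟶ B) (g : X ⟶ Y) :
    pushout (A ◁ g) (f ▷ X) ⟶ B ⊗ Y :=
  pushout.desc (f ▷ Y) (B ◁ g) (whisker_exchange f g)


section ParametrizedAdjunction

open Opposite

variable {C₁ C₂ C₃ : Type*} [Category* C₁] [Category* C₂] [Category* C₃]

/-- Right adjoints of the functors `F.obj X` assemble into a parametrized right adjoint. -/
lemma exists_parametrizedAdjunction (F : C₁ ⥤ C₂ ⥤ C₃) (hF : ∀ X, (F.obj X).IsLeftAdjoint) :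
    ∃ G : C₁ᵒᵖ ⥤ C₃ ⥤ C₂, Nonempty (F ⊣₂ G) := by
  let adj (X : C₁) : F.obj X ⊣ (F.obj X).rightAdjoint := Adjunction.ofIsLeftAdjoint (F.obj X)
  let G : C₁ᵒᵖ ⥤ C₃ ⥤ C₂ :=
    { obj X := (F.obj X.unop).rightAdjoint
      map f := conjugateEquiv (adj _) (adj _) (F.map f.unop)
      map_id X := by simp
      map_comp f g := by simp }
  exact ⟨G, ⟨{
    adj := adj
    unit_whiskerRight_map f := by
      ext X
      exact (unit_conjugateEquiv (adj _) (adj _) (F.map f) X).symm }⟩⟩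

end ParametrizedAdjunction

section PushoutProduct

variable {A B X Y U V : C}

omit [HasInitial C] [HasTerminal C] in
@[simp]
lemma inl_pp (f : A ⟶ B) (g : X ⟶ Y) : pushout.inl (A ◁ g) (f ▷ X) ≫ pp f g = f ▷ Y :=
  pushout.inl_desc _ _ _

omit [HasInitial C] [HasTerminal C] in
@[simp]
lemma inr_pp (f : A ⟶ B) (g : X ⟶ Y) : pushout.inr (A ◁ g) (f ▷ X) ≫ pp f g = B ◁ g :=
  pushout.inr_desc _ _ _

omit [HasInitial C] [HasTerminal C] in
@[simp]
lemma inl_pp_assoc (f : A ⟶ B) (g : X ⟶ Y) (h : B ⊗ Y ⟶ U) :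
    pushout.inl (A ◁ g) (f ▷ X) ≫ pp f g ≫ h = f ▷ Y ≫ h := by
  rw [← Category.assoc, inl_pp]

omit [HasInitial C] [HasTerminal C] in
@[simp]
lemma inr_pp_assoc (f : A ⟶ B) (g : X ⟶ Y) (h : B ⊗ Y ⟶ U) :
    pushout.inr (A ◁ g) (f ▷ X) ≫ pp f g ≫ h = B ◁ g ≫ h := by
  rw [← Category.assoc, inr_pp]

/-- The pushout-product, for the bifunctor `Y ↦ X ↦ X ⊗ Y`. -/
noncomputable def ppObjObj (f : A ⟶ B) (g : X ⟶ Y) :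
    (curriedTensor C).flip.PushoutObjObj g f where
  pt := pushout (A ◁ g) (f ▷ X)
  inl := pushout.inl _ _
  inr := pushout.inr _ _
  isPushout := IsPushout.of_hasPushout _ _
  ι := pp f g
  inl_ι := inl_pp f g
  inr_ι := inr_pp f g

omit [HasInitial C] [HasTerminal C] in
lemma exists_lift_pp {f : A ⟶ B} {g : X ⟶ Y} {q : U ⟶ V} (h : HasLiftingProperty (pp f g) q)
    (a : B ⊗ X ⟶ U) (b : A ⊗ Y ⟶ U) (v : B ⊗ Y ⟶ V)
    (hab : A ◁ g ≫ b = f ▷ X ≫ a) (ha : a ≫ q = B ◁ g ≫ v) (hb : b ≫ q = f ▷ Y ≫ v) :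
    ∃ l : B ⊗ Y ⟶ U, B ◁ g ≫ l = a ∧ f ▷ Y ≫ l = b ∧ l ≫ q = v := by
  have sq : CommSq (pushout.desc b a hab) (pp f g) q v := ⟨by
    apply pushout.hom_ext
    · rw [pushout.inl_desc_assoc, inl_pp_assoc, hb]
    · rw [pushout.inr_desc_assoc, inr_pp_assoc, ha]⟩
  refine ⟨sq.lift, ?_, ?_, sq.fac_right⟩
  · rw [← inr_pp_assoc, sq.fac_left, pushout.inr_desc]
  · rw [← inl_pp_assoc, sq.fac_left, pushout.inl_desc]

end PushoutProduct

section Closed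

open Opposite

variable {A B X Y U V : C}

omit [HasInitial C] [HasTerminal C] in
/-- The class of morphisms `f` for which `pp f g` has the left lifting property against `q`
is the class of morphisms lifting against a fixed morphism. -/
lemma exists_hasLiftingProperty_pp_iff_left [HasLimits C]
    (hclosed₂ : ∀ X : C, (tensorRight X).IsLeftAdjoint) (g : X ⟶ Y) (q : U ⟶ V) :
    ∃ (M N : C) (r : M ⟶ N), ∀ {A B : C} (f : A ⟶ B),
      HasLiftingProperty (pp f g) q ↔ HasLiftingProperty f r := by
  obtain ⟨G, ⟨adj⟩⟩ := exists_parametrizedAdjunction (curriedTensor C).flip hclosed₂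
  exact ⟨_, _, (Functor.PullbackObjObj.ofHasPullback G g q).π, fun f ↦
    adj.hasLiftingProperty_iff (ppObjObj f g) _⟩

omit [HasInitial C] in
/-- The class of morphisms `g` for which `pp f g` has the left lifting property against `q`
is the class of morphisms lifting against the pullback-hom. -/
lemma exists_hasLiftingProperty_pp_iff_right [HasLimits C]
    (hclosed₁ : ∀ X : C, (tensorLeft X).IsLeftAdjoint) (f : A ⟶ B) (q : U ⟶ V) :
    ∃ (HBU HBV HAU HAV P : C) (r : HBU ⟶ P) (p₁ : P ⟶ HAU) (p₂ : P ⟶ HBV) (s : HAU ⟶ HAV)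
        (t : HBV ⟶ HAV),
      IsPullback p₁ p₂ s t ∧
      (∀ {X Y : C} (g : X ⟶ Y), HasLiftingProperty (pp f g) q ↔ HasLiftingProperty g r) ∧
      (∀ {X Y : C} (g : X ⟶ Y), HasLiftingProperty (A ◁ g) q ↔ HasLiftingProperty g s) ∧
      (∀ {X Y : C} (g : X ⟶ Y), HasLiftingProperty (B ◁ g) q ↔
        HasLiftingProperty g (r ≫ p₂)) ∧
      (∀ {X Y : C} (g : X ⟶ Y), HasLiftingProperty (B ◁ g) (terminal.from V) ↔
        HasLiftingProperty g (terminal.from HBV)) := by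
  obtain ⟨G, ⟨adj⟩⟩ := exists_parametrizedAdjunction (curriedTensor C) hclosed₁
  let sq := Functor.PullbackObjObj.ofHasPullback G f q
  refine ⟨_, _, _, _, _, sq.π, _, _, _, _, sq.isPullback, fun g ↦
    adj.hasLiftingProperty_iff (ppObjObj f g).flip sq, fun g ↦
      (adj.adj A).hasLiftingProperty_iff g q, fun g ↦ ?_, fun g ↦ ?_⟩
  · rw [sq.π_snd]
    exact (adj.adj B).hasLiftingProperty_iff g q
  · have := (adj.adj B).rightAdjoint_preservesLimits
    refine ((adj.adj B).hasLiftingProperty_iff g (terminal.from V)).trans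
      (HasLiftingProperty.iff_of_arrow_iso_right g
        (Arrow.isoMk (Iso.refl _) (PreservesTerminal.iso _) (terminal.hom_ext _ _)))

end Closed

section Unit

variable {A B X Y U V : C}

omit [HasTerminal C] in
lemma hasLiftingProperty_whiskerLeft (hclosed₂ : ∀ X : C, (tensorRight X).IsLeftAdjoint)
    {g : X ⟶ Y} {q : U ⟶ V} (h : HasLiftingProperty (pp (initial.to A) g) q) :
    HasLiftingProperty (A ◁ g) q where
  sq_hasLift {a v} sq := by
    have hX (X : C) : IsInitial ((⊥_ C) ⊗ X) :=
      have := hclosed₂ X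
      IsInitial.isInitialObj (tensorRight X) _ initialIsInitial
    obtain ⟨l, h₁, -, h₂⟩ := exists_lift_pp h a ((hX Y).to U) v ((hX X).hom_ext _ _) sq.w
      ((hX Y).hom_ext _ _)
    exact ⟨⟨⟨l, h₁, h₂⟩⟩⟩

omit [HasInitial C] [HasTerminal C] [HasColimits C] in
lemma exists_lift_whiskerLeft_unit {g : 𝟙_ C ⟶ Y} {q : U ⟶ V} (h : HasLiftingProperty (A ◁ g) q)
    (u : A ⟶ U) (v : A ⊗ Y ⟶ V) (hu : u ≫ q = (ρ_ A).inv ≫ A ◁ g ≫ v) :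
    ∃ l : A ⊗ Y ⟶ U, (ρ_ A).inv ≫ A ◁ g ≫ l = u ∧ l ≫ q = v := by
  have sq : CommSq ((ρ_ A).hom ≫ u) (A ◁ g) q v := ⟨by simp [hu]⟩
  exact ⟨sq.lift, by simp, sq.fac_right⟩

omit [HasInitial C] [HasTerminal C] in
lemma exists_lift_pp_unit {f : A ⟶ B} {g : 𝟙_ C ⟶ Y} {q : U ⟶ V}
    (h : HasLiftingProperty (pp f g) q) (u : B ⟶ U) (b : A ⊗ Y ⟶ U) (v : B ⊗ Y ⟶ V)
    (hub : f ≫ u = (ρ_ A).inv ≫ A ◁ g ≫ b) (hu : u ≫ q = (ρ_ B).inv ≫ B ◁ g ≫ v)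
    (hb : b ≫ q = f ▷ Y ≫ v) :
    ∃ l : B ⊗ Y ⟶ U, (ρ_ B).inv ≫ B ◁ g ≫ l = u ∧ f ▷ Y ≫ l = b ∧ l ≫ q = v := by
  obtain ⟨l, h₁, h₂, h₃⟩ := exists_lift_pp h ((ρ_ B).hom ≫ u) b v
    (by rw [rightUnitor_naturality_assoc, hub, Iso.hom_inv_id_assoc]) (by simp [hu]) hb
  exact ⟨l, by simp [h₁], h₂, h₃⟩

omit [HasInitial C] [HasTerminal C] in
lemma tensor_coprod_hom_ext (hclosed₁ : ∀ X : C, (tensorLeft X).IsLeftAdjoint)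
    {a b : A ⊗ (X ⨿ Y) ⟶ U} (hl : A ◁ coprod.inl ≫ a = A ◁ coprod.inl ≫ b)
    (hr : A ◁ coprod.inr ≫ a = A ◁ coprod.inr ≫ b) : a = b := by
  have := hclosed₁ A
  let adj := Adjunction.ofIsLeftAdjoint (tensorLeft A)
  apply (adj.homEquiv _ _).injective
  apply coprod.hom_ext
  · rw [← adj.homEquiv_naturality_left, ← adj.homEquiv_naturality_left]
    exact congrArg _ hl
  · rw [← adj.homEquiv_naturality_left, ← adj.homEquiv_naturality_left]
    exact congrArg _ hr

omit [HasInitial C] [HasTerminal C] in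
lemma exists_tensor_coprod_desc (hclosed₁ : ∀ X : C, (tensorLeft X).IsLeftAdjoint)
    (a : A ⊗ X ⟶ U) (b : A ⊗ Y ⟶ U) :
    ∃ l : A ⊗ (X ⨿ Y) ⟶ U, A ◁ coprod.inl ≫ l = a ∧ A ◁ coprod.inr ≫ l = b := by
  have := hclosed₁ A
  let adj := Adjunction.ofIsLeftAdjoint (tensorLeft A)
  refine ⟨(adj.homEquiv _ _).symm (coprod.desc (adj.homEquiv _ _ a) (adj.homEquiv _ _ b)), ?_, ?_⟩
  · exact (adj.homEquiv_naturality_left_symm _ _).symm.trans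
      (by rw [coprod.inl_desc, Equiv.symm_apply_apply])
  · exact (adj.homEquiv_naturality_left_symm _ _).symm.trans
      (by rw [coprod.inr_desc, Equiv.symm_apply_apply])

omit [HasInitial C] [HasTerminal C] in
lemma exists_lift_pp_coprod (hclosed₁ : ∀ X : C, (tensorLeft X).IsLeftAdjoint)
    {f : A ⟶ B} {g : 𝟙_ C ⨿ 𝟙_ C ⟶ Y} {q : U ⟶ V}
    (h : HasLiftingProperty (pp f g) q) (u₀ u₁ : B ⟶ U) (b : A ⊗ Y ⟶ U) (v : B ⊗ Y ⟶ V)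
    (hub₀ : f ≫ u₀ = (ρ_ A).inv ≫ A ◁ (coprod.inl ≫ g) ≫ b)
    (hub₁ : f ≫ u₁ = (ρ_ A).inv ≫ A ◁ (coprod.inr ≫ g) ≫ b)
    (hu₀ : u₀ ≫ q = (ρ_ B).inv ≫ B ◁ (coprod.inl ≫ g) ≫ v)
    (hu₁ : u₁ ≫ q = (ρ_ B).inv ≫ B ◁ (coprod.inr ≫ g) ≫ v)
    (hb : b ≫ q = f ▷ Y ≫ v) :
    ∃ l : B ⊗ Y ⟶ U, (ρ_ B).inv ≫ B ◁ (coprod.inl ≫ g) ≫ l = u₀ ∧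
      (ρ_ B).inv ≫ B ◁ (coprod.inr ≫ g) ≫ l = u₁ ∧ f ▷ Y ≫ l = b ∧ l ≫ q = v := by
  obtain ⟨a, ha₀, ha₁⟩ := exists_tensor_coprod_desc hclosed₁ ((ρ_ B).hom ≫ u₀) ((ρ_ B).hom ≫ u₁)
  obtain ⟨l, h₁, h₂, h₃⟩ := exists_lift_pp h a b v
    (tensor_coprod_hom_ext hclosed₁
      (by rw [whisker_exchange_assoc, ha₀, rightUnitor_naturality_assoc, hub₀]; simp)
      (by rw [whisker_exchange_assoc, ha₁, rightUnitor_naturality_assoc, hub₁]; simp))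
    (tensor_coprod_hom_ext hclosed₁
      (by rw [reassoc_of% ha₀, hu₀]; simp) (by rw [reassoc_of% ha₁, hu₁]; simp)) hb
  exact ⟨l, by simp [h₁, ha₀], by simp [h₁, ha₁], h₂, h₃⟩

end Unit

/-- The left lifting property against all `J`-fibrations between `J`-fibrant objects. -/
def FibrantLlp (J : MorphismProperty C) : MorphismProperty C := fun _ _ i ↦
  ∀ ⦃U V : C⦄ (q : U ⟶ V), Rlp J q → Fibrant (Rlp J) U → Fibrant (Rlp J) V →
    HasLiftingProperty i q

section Classes

variable (S : MorphismProperty C) {A B X Y U V : C}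

omit [MonoidalCategory C] [HasColimits C] [HasInitial C] in
lemma fibrant_terminal : Fibrant (Rlp S) (⊤_ C) := by
  have : IsIso (terminal.from (⊤_ C)) := isIso_of_isTerminal terminalIsTerminal terminalIsTerminal _
  exact S.rlp_of_isIso _

variable {S}

omit [MonoidalCategory C] [HasColimits C] [HasInitial C] in
lemma Fibrant.of_rlp {p : X ⟶ Y} (hp : Rlp S p) (hY : Fibrant (Rlp S) Y) : Fibrant (Rlp S) X := by
  have := S.rlp.comp_mem p (terminal.from Y) hp hY
  rwa [terminal.comp_from] at this

omit [MonoidalCategory C] [HasColimits C] [HasTerminal C] in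
lemma Cofibrant.of_llp {i : X ⟶ Y} (hi : Llp S i) (hX : Cofibrant (Llp S) X) :
    Cofibrant (Llp S) Y := by
  have := S.llp.comp_mem (initial.to X) i hX hi
  rwa [initial.to_comp] at this

omit [HasColimits C] [HasInitial C] [HasTerminal C] [MonoidalCategory C] in
lemma isFibClass_rlp [HasTerminal C] [HasPullbacks C] (S : MorphismProperty C) :
    IsFibClass (Rlp S) where
  terminal_fibrant := fibrant_terminal S
  iso_mem f _ _ := S.rlp_of_isIso f
  comp_mem f g hf hg := S.rlp.comp_mem f g hf hg
  pullback_mem p f hp _ _ := ⟨pullback f p, pullback.fst f p, pullback.snd f p,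
    IsPullback.of_hasPullback f p,
    S.rlp.of_isPullback (IsPullback.of_hasPullback f p).flip hp⟩

omit [HasColimits C] [HasInitial C] [HasTerminal C] [MonoidalCategory C] in
lemma isCofClass_llp [HasInitial C] [HasPushouts C] (S : MorphismProperty C) :
    IsCofClass (Llp S) where
  initial_cofibrant := by
    have : IsIso (initial.to (⊥_ C)) := isIso_of_isInitial initialIsInitial initialIsInitial _
    exact S.llp_of_isIso _
  iso_mem f _ _ := S.llp_of_isIso f
  comp_mem f g hf hg := S.llp.comp_mem f g hf hg
  pushout_mem i f hi _ _ := ⟨pushout f i, pushout.inl f i, pushout.inr f i,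
    IsPushout.of_hasPushout f i,
    S.llp.of_isPushout (IsPushout.of_hasPushout f i) hi⟩

omit [HasInitial C] in
lemma FibrantLlp.pp [HasLimits C] (hclosed₁ : ∀ X : C, (tensorLeft X).IsLeftAdjoint)
    {J : MorphismProperty C} {f : A ⟶ B} {g : X ⟶ Y} (hg : FibrantLlp J g)
    (hf : ∀ ⦃X Y : C⦄ (j : X ⟶ Y), J j → FibrantLlp J (pp f j))
    (hA : ∀ ⦃X Y : C⦄ (j : X ⟶ Y), J j → FibrantLlp J (A ◁ j))
    (hB : ∀ ⦃X Y : C⦄ (j : X ⟶ Y), J j → FibrantLlp J (B ◁ j)) :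
    FibrantLlp J (pp f g) := by
  intro U V q hq hU hV
  obtain ⟨_, HBV, _, _, P, r, p₁, p₂, s, t, sq, h₁, h₂, -, h₄⟩ :=
    exists_hasLiftingProperty_pp_iff_right hclosed₁ f q
  have hr : Rlp J r := fun _ _ j hj ↦ (h₁ j).1 (hf j hj q hq hU hV)
  have hp₂ : Rlp J p₂ := J.rlp.of_isPullback sq
    fun _ _ j hj ↦ (h₂ j).1 (hA j hj q hq hU hV)
  have hHBV : Fibrant (Rlp J) HBV := fun _ _ j hj ↦
    (h₄ j).1 (hB j hj _ hV hV (fibrant_terminal J))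
  have hP := hHBV.of_rlp hp₂
  exact (h₁ g).2 (hg r hr (hP.of_rlp hr) hP)

end Classes

section CylinderPath

variable {I J : MorphismProperty C} {C₀ D : C} {c : 𝟙_ C ⨿ 𝟙_ C ⟶ C₀} {d : C₀ ⟶ D} {e : 𝟙_ C ⟶ D}

omit [HasInitial C] in
lemma nonempty_relStrongCylinder (hclosed₁ : ∀ X : C, (tensorLeft X).IsLeftAdjoint)
    (hc : c ≫ d = codiag (𝟙_ C) ≫ e) {A B : C} {i : A ⟶ B}
    (hi : Llp (Rlp I) i) (r : B ⊗ D ⟶ B) (hr : (ρ_ B).inv ≫ B ◁ e ≫ r = 𝟙 B)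
    (hAe : Llp (Rlp I) (A ◁ e)) (hAe' : FibrantLlp J (A ◁ e))
    (hic : Llp (Rlp I) (pp i c)) (hic' : FibrantLlp J (pp i (coprod.inl ≫ c))) :
    Nonempty (RelStrongCylinder (Llp (Rlp I)) (Rlp J) i) := by
  have hc₀ : coprod.inl ≫ c ≫ d = e := by
    rw [hc]; exact (coprod.inl_desc_assoc _ _ _).trans (Category.id_comp _)
  have hc₁ : coprod.inr ≫ c ≫ d = e := by
    rw [hc]; exact (coprod.inr_desc_assoc _ _ _).trans (Category.id_comp _)
  have hA₀ : (ρ_ A).inv ≫ A ◁ (coprod.inl ≫ c) ≫ A ◁ d = (ρ_ A).inv ≫ A ◁ e := by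
    rw [← whiskerLeft_comp, Category.assoc, hc₀]
  have hA₁ : (ρ_ A).inv ≫ A ◁ (coprod.inr ≫ c) ≫ A ◁ d = (ρ_ A).inv ≫ A ◁ e := by
    rw [← whiskerLeft_comp, Category.assoc, hc₁]
  have hB₀ : (ρ_ B).inv ≫ B ◁ (coprod.inl ≫ c) ≫ B ◁ d ≫ r = 𝟙 B := by
    rw [← whiskerLeft_comp_assoc, Category.assoc, hc₀, hr]
  have hB₁ : (ρ_ B).inv ≫ B ◁ (coprod.inr ≫ c) ≫ B ◁ d ≫ r = 𝟙 B := by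
    rw [← whiskerLeft_comp_assoc, Category.assoc, hc₁, hr]
  have sqE : IsPushout (i ▷ C₀) (A ◁ d) (pushout.inl (i ▷ C₀) (A ◁ d)) (pushout.inr _ _) :=
    IsPushout.of_hasPushout _ _
  have sqB : IsPushout i i (pushout.inl i i) (pushout.inr i i) := IsPushout.of_hasPushout _ _
  generalize pushout (i ▷ C₀) (A ◁ d) = E, pushout.inl (i ▷ C₀) (A ◁ d) = κ,
    pushout.inr (i ▷ C₀) (A ◁ d) = μ at sqE
  generalize pushout i i = BB, pushout.inl i i = in₀, pushout.inr i i = in₁ at sqB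
  have hκ₀ : i ≫ (ρ_ B).inv ≫ B ◁ (coprod.inl ≫ c) ≫ κ = (ρ_ A).inv ≫ A ◁ e ≫ μ := by
    rw [rightUnitor_inv_naturality_assoc, ← whisker_exchange_assoc, sqE.w, reassoc_of% hA₀]
  have hκ₁ : i ≫ (ρ_ B).inv ≫ B ◁ (coprod.inr ≫ c) ≫ κ = (ρ_ A).inv ≫ A ◁ e ≫ μ := by
    rw [rightUnitor_inv_naturality_assoc, ← whisker_exchange_assoc, sqE.w, reassoc_of% hA₁]
  obtain ⟨ι, hι₀, hι₁⟩ := sqB.exists_desc _ _ (hκ₀.trans hκ₁.symm)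
  obtain ⟨ρ, hκρ, -⟩ := sqE.exists_desc (B ◁ d ≫ r) (i ▷ D ≫ r) (whisker_exchange_assoc _ _ _).symm
  have hι : Llp (Rlp I) ι := by
    intro U V q hq
    refine ⟨fun {u v} sq ↦ ?_⟩
    obtain ⟨h, h₁, h₂⟩ := exists_lift_whiskerLeft_unit (hAe q hq) (i ≫ in₀ ≫ u) (μ ≫ v)
      (by simp only [Category.assoc]; rw [sq.w, reassoc_of% hι₀, reassoc_of% hκ₀])
    obtain ⟨l, h₃, h₄, h₅, h₆⟩ := exists_lift_pp_coprod hclosed₁ (hic q hq) (in₀ ≫ u) (in₁ ≫ u)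
      (A ◁ d ≫ h) (κ ≫ v) (by rw [reassoc_of% hA₀, h₁])
      (by rw [reassoc_of% hA₁, h₁, sqB.w_assoc])
      (by rw [Category.assoc, sq.w, reassoc_of% hι₀]) (by rw [Category.assoc, sq.w, reassoc_of% hι₁])
      (by rw [Category.assoc, h₂, sqE.w_assoc])
    obtain ⟨w, hw₁, hw₂⟩ := sqE.exists_desc l h h₅
    exact ⟨⟨⟨w, sqB.hom_ext (by rw [reassoc_of% hι₀, hw₁, h₃]) (by rw [reassoc_of% hι₁, hw₁, h₄]),
      sqE.hom_ext (by rw [reassoc_of% hw₁, h₆]) (by rw [reassoc_of% hw₂, h₂])⟩⟩⟩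
  have hin₀ : Llp (Rlp I) in₀ := (Rlp I).llp.of_isPushout sqB hi
  refine ⟨⟨BB, in₀, in₁, sqB, E, ι, ρ, hι, ⟨(Rlp I).llp.comp_mem _ _ hin₀ hι, ?_⟩, ?_, ?_⟩⟩
  · intro U V q hq hU hV
    refine ⟨fun {u v} sq ↦ ?_⟩
    replace sq := sq.w
    rw [hι₀, Category.assoc, Category.assoc] at sq
    obtain ⟨h, h₁, h₂⟩ := exists_lift_whiskerLeft_unit (hAe' q hq hU hV) (i ≫ u) (μ ≫ v)
      (by rw [Category.assoc, sq, reassoc_of% hκ₀])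
    obtain ⟨l, h₃, h₅, h₆⟩ := exists_lift_pp_unit (hic' q hq hU hV) u
      (A ◁ d ≫ h) (κ ≫ v) (by rw [reassoc_of% hA₀, h₁]) sq
      (by rw [Category.assoc, h₂, sqE.w_assoc])
    obtain ⟨w, hw₁, hw₂⟩ := sqE.exists_desc l h h₅
    exact ⟨⟨⟨w, by rw [hι₀, Category.assoc, Category.assoc, hw₁, h₃],
      sqE.hom_ext (by rw [reassoc_of% hw₁, h₆]) (by rw [reassoc_of% hw₂, h₂])⟩⟩⟩
  · rw [reassoc_of% hι₀, hκρ, hB₀]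
  · rw [reassoc_of% hι₁, hκρ, hB₁]

omit [HasInitial C] [HasTerminal C] [HasColimits C] in
/-- The object representing compatible pairs of morphisms `T ⊗ C₀ ⟶ Y` and `T ⊗ D ⟶ X`. -/
lemma exists_tensor_pullback [HasLimits C] (hclosed₂ : ∀ X : C, (tensorRight X).IsLeftAdjoint)
    (d : C₀ ⟶ D) {X Y : C} (q : Y ⟶ X) :
    ∃ (P : C) (α : P ⊗ C₀ ⟶ Y) (β : P ⊗ D ⟶ X), α ≫ q = P ◁ d ≫ β ∧
      (∀ ⦃T : C⦄ (a : T ⊗ C₀ ⟶ Y) (b : T ⊗ D ⟶ X), a ≫ q = T ◁ d ≫ b →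
        ∃ t : T ⟶ P, t ▷ C₀ ≫ α = a ∧ t ▷ D ≫ β = b) ∧
      ∀ ⦃T : C⦄ (t t' : T ⟶ P), t ▷ C₀ ≫ α = t' ▷ C₀ ≫ α → t ▷ D ≫ β = t' ▷ D ≫ β → t = t' := by
  obtain ⟨G, ⟨adj⟩⟩ := exists_parametrizedAdjunction (curriedTensor C).flip hclosed₂
  let sq := Functor.PullbackObjObj.ofHasPullback G d q
  have hα {T : C} (t : T ⟶ sq.pt) :
      t ▷ C₀ ≫ adj.homEquiv.symm sq.fst = adj.homEquiv.symm (t ≫ sq.fst) :=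
    (adj.homEquiv_symm_naturality_two t sq.fst).symm
  have hβ {T : C} (t : T ⟶ sq.pt) :
      t ▷ D ≫ adj.homEquiv.symm sq.snd = adj.homEquiv.symm (t ≫ sq.snd) :=
    (adj.homEquiv_symm_naturality_two t sq.snd).symm
  refine ⟨sq.pt, adj.homEquiv.symm sq.fst, adj.homEquiv.symm sq.snd, ?_, fun T a b hab ↦ ?_,
    fun T t t' h₁ h₂ ↦ sq.isPullback.hom_ext ?_ ?_⟩
  · rw [← adj.homEquiv_symm_naturality_three, sq.isPullback.w]
    exact adj.homEquiv_symm_naturality_one d sq.snd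
  · obtain ⟨t, ht₁, ht₂⟩ := sq.isPullback.exists_lift (adj.homEquiv a) (adj.homEquiv b) (by
      rw [← adj.homEquiv_naturality_three, ← adj.homEquiv_naturality_one]
      exact congrArg _ hab)
    exact ⟨t, by rw [hα, ht₁, Equiv.symm_apply_apply], by rw [hβ, ht₂, Equiv.symm_apply_apply]⟩
  · rw [hα, hα] at h₁
    exact adj.homEquiv.symm.injective h₁
  · rw [hβ, hβ] at h₂
    exact adj.homEquiv.symm.injective h₂

lemma nonempty_relStrongPath [HasLimits C] (hclosed₁ : ∀ X : C, (tensorLeft X).IsLeftAdjoint)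
    (hclosed₂ : ∀ X : C, (tensorRight X).IsLeftAdjoint)
    (hc : c ≫ d = codiag (𝟙_ C) ≫ e) {X Y : C} {q : Y ⟶ X}
    (hq : Rlp J q) (r : Y ⊗ D ⟶ Y) (hr : (ρ_ Y).inv ≫ Y ◁ e ≫ r = 𝟙 Y)
    (hje : ∀ ⦃S T : C⦄ (j : S ⟶ T), J j → HasLiftingProperty (pp j e) (terminal.from X))
    (hjc : ∀ ⦃S T : C⦄ (j : S ⟶ T), J j → HasLiftingProperty (pp j c) q)
    (hie : ∀ ⦃A B : C⦄ (i : A ⟶ B), Llp (Rlp I) i → Cofibrant (Llp (Rlp I)) A →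
      Cofibrant (Llp (Rlp I)) B → HasLiftingProperty (pp i e) (terminal.from X))
    (hic : ∀ ⦃A B : C⦄ (i : A ⟶ B), Llp (Rlp I) i → Cofibrant (Llp (Rlp I)) A →
      Cofibrant (Llp (Rlp I)) B → HasLiftingProperty (pp i (coprod.inl ≫ c)) q) :
    Nonempty (RelStrongPath (Llp (Rlp I)) (Rlp J) q) := by
  have hc₀ : coprod.inl ≫ c ≫ d = e := by
    rw [hc]; exact (coprod.inl_desc_assoc _ _ _).trans (Category.id_comp _)
  have hc₁ : coprod.inr ≫ c ≫ d = e := by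
    rw [hc]; exact (coprod.inr_desc_assoc _ _ _).trans (Category.id_comp _)
  have hT₀ (T : C) : (ρ_ T).inv ≫ T ◁ (coprod.inl ≫ c) ≫ T ◁ d = (ρ_ T).inv ≫ T ◁ e := by
    rw [← whiskerLeft_comp, Category.assoc, hc₀]
  have hT₁ (T : C) : (ρ_ T).inv ≫ T ◁ (coprod.inr ≫ c) ≫ T ◁ d = (ρ_ T).inv ≫ T ◁ e := by
    rw [← whiskerLeft_comp, Category.assoc, hc₁]
  obtain ⟨P, α, β, hαβ, hP, hP'⟩ := exists_tensor_pullback hclosed₂ d q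
  have sqY : IsPullback (pullback.fst q q) (pullback.snd q q) q q := IsPullback.of_hasPullback _ _
  generalize pullback q q = YY, pullback.fst q q = pr₀, pullback.snd q q = pr₁ at sqY
  obtain ⟨π, hπ₀, hπ₁⟩ := sqY.exists_lift ((ρ_ P).inv ≫ P ◁ (coprod.inl ≫ c) ≫ α)
    ((ρ_ P).inv ≫ P ◁ (coprod.inr ≫ c) ≫ α) (by
      simp only [Category.assoc]; rw [hαβ, reassoc_of% hT₀, reassoc_of% hT₁])
  have hev₀ {T : C} (t : T ⟶ P) :
      t ≫ π ≫ pr₀ = (ρ_ T).inv ≫ T ◁ (coprod.inl ≫ c) ≫ t ▷ C₀ ≫ α := by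
    rw [hπ₀, rightUnitor_inv_naturality_assoc, whisker_exchange_assoc]
  have hev₁ {T : C} (t : T ⟶ P) :
      t ≫ π ≫ pr₁ = (ρ_ T).inv ≫ T ◁ (coprod.inr ≫ c) ≫ t ▷ C₀ ≫ α := by
    rw [hπ₁, rightUnitor_inv_naturality_assoc, whisker_exchange_assoc]
  have hevq {T : C} (t : T ⟶ P) : t ≫ π ≫ pr₀ ≫ q = (ρ_ T).inv ≫ T ◁ e ≫ t ▷ D ≫ β := by
    rw [reassoc_of% hev₀ t, hαβ, ← whisker_exchange_assoc, reassoc_of% hT₀]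
  have hπ : Rlp J π := by
    intro S T j hj
    refine ⟨fun {s t} sq ↦ ?_⟩
    obtain ⟨b, hb₁, hb₂, -⟩ := exists_lift_pp_unit (hje j hj) (t ≫ pr₀ ≫ q) (s ▷ D ≫ β)
      (terminal.from _) (by rw [← sq.w_assoc, hevq]) (terminal.hom_ext _ _) (terminal.hom_ext _ _)
    obtain ⟨l, hl₁, hl₂, hl₃, hl₄⟩ := exists_lift_pp_coprod hclosed₁ (hjc j hj) (t ≫ pr₀)
      (t ≫ pr₁) (s ▷ C₀ ≫ α) (T ◁ d ≫ b) (by rw [← sq.w_assoc, hev₀])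
      (by rw [← sq.w_assoc, hev₁]) (by rw [Category.assoc, reassoc_of% hT₀, hb₁])
      (by rw [Category.assoc, ← sqY.w, reassoc_of% hT₁, hb₁])
      (by rw [Category.assoc, hαβ, ← whisker_exchange_assoc, ← whisker_exchange_assoc, hb₂])
    obtain ⟨w, hw₁, hw₂⟩ := hP l b hl₄
    exact ⟨⟨⟨w,
      hP' _ _ (by rw [comp_whiskerRight_assoc, hw₁, hl₃]) (by rw [comp_whiskerRight_assoc, hw₂, hb₂]),
      sqY.hom_ext (by rw [Category.assoc, hev₀, hw₁, hl₁])
        (by rw [Category.assoc, hev₁, hw₁, hl₂])⟩⟩⟩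
  have hpr₀ : Rlp J pr₀ := J.rlp.of_isPullback sqY.flip hq
  obtain ⟨σ, hσ, -⟩ := hP (Y ◁ d ≫ r) (r ≫ q) (Category.assoc _ _ _)
  refine ⟨⟨YY, pr₀, pr₁, sqY, P, π, σ, hπ, ⟨J.rlp.comp_mem _ _ hπ hpr₀, ?_⟩, ?_, ?_⟩⟩
  · intro A B i hi hA hB
    refine ⟨fun {s t} sq ↦ ?_⟩
    replace sq := sq.w
    obtain ⟨b, hb₁, hb₂, -⟩ := exists_lift_pp_unit (hie i hi hA hB) (t ≫ q) (s ▷ D ≫ β)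
      (terminal.from _) (by rw [← reassoc_of% sq, hevq]) (terminal.hom_ext _ _)
      (terminal.hom_ext _ _)
    obtain ⟨l, hl₁, hl₃, hl₄⟩ := exists_lift_pp_unit (hic i hi hA hB) t (s ▷ C₀ ≫ α) (B ◁ d ≫ b)
      (by rw [← sq, hev₀]) (by rw [reassoc_of% hT₀, hb₁])
      (by rw [Category.assoc, hαβ, ← whisker_exchange_assoc, ← whisker_exchange_assoc, hb₂])
    obtain ⟨w, hw₁, hw₂⟩ := hP l b hl₄
    exact ⟨⟨⟨w,
      hP' _ _ (by rw [comp_whiskerRight_assoc, hw₁, hl₃]) (by rw [comp_whiskerRight_assoc, hw₂, hb₂]),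
      by rw [hev₀, hw₁, hl₁]⟩⟩⟩
  · rw [hev₀, hσ, reassoc_of% hT₀, hr]
  · rw [hev₁, hσ, reassoc_of% hT₁, hr]

end CylinderPath

/-- the monoidal Cisinski–Olschok type construction of a weak model
structure, with cofibrations the `I`-cofibrations and fibrations the `J`-fibrations. -/
theorem statement11 [HasLimits C]
    (hclosed₁ : ∀ X : C, (tensorLeft X).IsLeftAdjoint)
    (hclosed₂ : ∀ X : C, (tensorRight X).IsLeftAdjoint)
    (I J : MorphismProperty C)
    -- (1) the two weak factorization systems
    (hfacI : ∀ {X Y : C} (f : X ⟶ Y), ∃ (Z : C) (i : X ⟶ Z) (q : Z ⟶ Y),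
      Llp (Rlp I) i ∧ Rlp I q ∧ i ≫ q = f)
    (hfacJ : ∀ {X Y : C} (f : X ⟶ Y), ∃ (Z : C) (i : X ⟶ Z) (q : Z ⟶ Y),
      Llp (Rlp J) i ∧ Rlp J q ∧ i ≫ q = f)
    -- (2) every member of J is an I-cofibration
    (hJI : ∀ {X Y : C} (j : X ⟶ Y), J j → Llp (Rlp I) j)
    -- (3) pushout-products of members of I are I-cofibrations
    (hII : ∀ {A B X Y : C} (i : A ⟶ B) (i' : X ⟶ Y), I i → I i' → Llp (Rlp I) (pp i i'))
    -- (4) mixed pushout-products lift against J-fibrations between J-fibrant objects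
    (hIJ : ∀ {A B X Y : C} (i : A ⟶ B) (j : X ⟶ Y), I i → J j →
      ∀ {U V : C} (q : U ⟶ V), Rlp J q → Rlp J (terminal.from U) → Rlp J (terminal.from V) →
        HasLiftingProperty (pp i j) q ∧ HasLiftingProperty (pp j i) q)
    -- (5) the unit is I-cofibrant
    (hunit : Llp (Rlp I) (initial.to (𝟙_ C)))
    -- (6) a weak cylinder for the unit
    (hcyl : ∃ (C₀ D : C) (c : (𝟙_ C) ⨿ (𝟙_ C) ⟶ C₀) (d : C₀ ⟶ D) (e : 𝟙_ C ⟶ D),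
      Llp (Rlp I) c ∧ c ≫ d = codiag (𝟙_ C) ≫ e ∧
      (Llp (Rlp I) e ∧ ∀ {U V : C} (q : U ⟶ V), Rlp J q → Rlp J (terminal.from U) →
        Rlp J (terminal.from V) → HasLiftingProperty e q) ∧
      (Llp (Rlp I) (coprod.inl ≫ c) ∧ ∀ {U V : C} (q : U ⟶ V), Rlp J q →
        Rlp J (terminal.from U) → Rlp J (terminal.from V) →
        HasLiftingProperty (coprod.inl ≫ c) q)) :
    IsWeakModel (Llp (Rlp I)) (Rlp J) := by
  have hIJ_rlp {U V : C} (q : U ⟶ V) (hq : Rlp I q) : Rlp J q := fun _ _ j hj ↦ hJI j hj q hq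
  obtain ⟨C₀, D, c, d, e, hc, hcd, ⟨he, he'⟩, hc₀, hc₀'⟩ := hcyl
  replace he' : FibrantLlp J e := fun _ _ q ↦ he' q
  replace hc₀' : FibrantLlp J (coprod.inl ≫ c) := fun _ _ q ↦ hc₀' q
  have hpp {A B X Y : C} (f : A ⟶ B) (g : X ⟶ Y) (hf : Llp (Rlp I) f) (hg : Llp (Rlp I) g) :
      Llp (Rlp I) (pp f g) := by
    intro U V q hq
    obtain ⟨_, _, _, _, _, r, _, _, _, _, -, h, -⟩ :=
      exists_hasLiftingProperty_pp_iff_right hclosed₁ f q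
    refine (h g).2 (hg r fun _ _ i' hi' ↦ (h i').1 ?_)
    obtain ⟨_, _, r', h'⟩ := exists_hasLiftingProperty_pp_iff_left hclosed₂ i' q
    exact (h' f).2 (hf r' fun _ _ i hi ↦ (h' i).1 (hII i i' hi hi' q hq))
  have hppJ {A B X Y : C} (f : A ⟶ B) (hf : Llp (Rlp I) f) (j : X ⟶ Y) (hj : J j) :
      FibrantLlp J (pp f j) := by
    intro U V q hq hU hV
    obtain ⟨_, _, r, h⟩ := exists_hasLiftingProperty_pp_iff_left hclosed₂ j q
    exact (h f).2 (hf r fun _ _ i hi ↦ (h i).1 (hIJ i j hi hj q hq hU hV).1)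
  have hJpp {A B X Y : C} (f : A ⟶ B) (hf : Llp (Rlp I) f) (j : X ⟶ Y) (hj : J j) :
      FibrantLlp J (pp j f) := by
    intro U V q hq hU hV
    obtain ⟨_, _, _, _, _, r, _, _, _, _, -, h, -⟩ :=
      exists_hasLiftingProperty_pp_iff_right hclosed₁ j q
    exact (h f).2 (hf r fun _ _ i hi ↦ (h i).1 (hIJ i j hi hj q hq hU hV).2)
  have hwhiskerJ {A X Y : C} (hA : Cofibrant (Llp (Rlp I)) A) (j : X ⟶ Y) (hj : J j) :
      FibrantLlp J (A ◁ j) := fun _ _ q hq hU hV ↦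
    hasLiftingProperty_whiskerLeft hclosed₂ (hppJ _ hA j hj q hq hU hV)
  have hppW {A B X Y : C} (f : A ⟶ B) (g : X ⟶ Y) (hf : Llp (Rlp I) f)
      (hA : Cofibrant (Llp (Rlp I)) A) (hg : FibrantLlp J g) : FibrantLlp J (pp f g) :=
    hg.pp hclosed₁ (fun _ _ j hj ↦ hppJ f hf j hj) (fun _ _ j hj ↦ hwhiskerJ hA j hj)
      (fun _ _ j hj ↦ hwhiskerJ (hA.of_llp hf) j hj)
  have hwhiskerW {A X Y : C} (hA : Cofibrant (Llp (Rlp I)) A) (g : X ⟶ Y) (hg : FibrantLlp J g) :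
      FibrantLlp J (A ◁ g) := fun _ _ q hq hU hV ↦
    hasLiftingProperty_whiskerLeft hclosed₂
      (hppW _ g hA (isCofClass_llp (Rlp I)).initial_cofibrant hg q hq hU hV)
  have hretract {B : C} (hB : Cofibrant (Llp (Rlp I)) B) (hB' : Fibrant (Rlp J) B) :
      ∃ r : B ⊗ D ⟶ B, (ρ_ B).inv ≫ B ◁ e ≫ r = 𝟙 B := by
    obtain ⟨r, hr, -⟩ := exists_lift_whiskerLeft_unit
      (hwhiskerW hB e he' _ hB' hB' (fibrant_terminal J)) (𝟙 B) (terminal.from _)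
      (terminal.hom_ext _ _)
    exact ⟨r, hr⟩
  exact {
    cofClass := isCofClass_llp _
    fibClass := isFibClass_rlp _
    factor_cof_afib f _ _ := by
      obtain ⟨Z, i, q, hi, hq, fac⟩ := hfacI f
      exact ⟨Z, i, q, hi, ⟨hIJ_rlp q hq, fun i' hi' _ _ ↦ hi' q hq⟩, fac⟩
    factor_acof_fib f _ _ := by
      obtain ⟨Z, i, q, hi, hq, fac⟩ := hfacJ f
      exact ⟨Z, i, q, ⟨fun _ _ p hp ↦ hi p (hIJ_rlp p hp), fun p hp _ _ ↦ hi p hp⟩, hq, fac⟩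
    cylinder {A B} i hi hA hB := by
      obtain ⟨r, hr⟩ := hretract (hA.of_llp hi) hB
      exact nonempty_relStrongCylinder hclosed₁ hcd hi r hr
        (fun _ _ q hq ↦ hasLiftingProperty_whiskerLeft hclosed₂ (hpp _ e hA he q hq))
        (hwhiskerW hA e he') (hpp i c hi hc) (hppW i _ hi hA hc₀')
    pathObj {X Y} q hq hY hX := by
      have hY' := hX.of_rlp hq
      obtain ⟨r, hr⟩ := hretract hY hY'
      exact nonempty_relStrongPath hclosed₁ hclosed₂ hcd hq r hr
        (fun _ _ j hj ↦ hJpp e he j hj _ hX hX (fibrant_terminal J))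
        (fun _ _ j hj ↦ hJpp c hc j hj q hq hY' hX)
        (fun _ _ i hi hA _ ↦ hppW i e hi hA he' _ hX hX (fibrant_terminal J))
        (fun _ _ i hi hA _ ↦ hppW i _ hi hA hc₀' q hq hY' hX) }

end WMC
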